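/- Let L be a Heyting algebra with finite connected decompositions. If L contains no duality pair, then there is no finite duality (A, B) in L with both A and B nonempty. -/

import Mathlib

open Set

/-- `upSet M = {x | ∃ m ∈ M, m ≤ x}`. -/
def upSet {L : Type*} [Preorder L] (M : Set L) : Set L := {x | ∃ m ∈ M, m ≤ x}

/-- `downSet M = {x | ∃ m ∈ M, x ≤ m}`. -/
def downSet {L : Type*} [Preorder L] (M : Set L) : Set L := {x | ∃ m ∈ M, x ≤ m}

/-- A finite duality `(A, B)`: finite antichains such that
`x ∈ ↑A` iff `x ∉ ↓B`. -/
def FiniteDuality {L : Type*} [Preorder L] (A B : Set L) : Prop :=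
  A.Finite ∧ B.Finite ∧ IsAntichain (· ≤ ·) A ∧ IsAntichain (· ≤ ·) B ∧
    ∀ x : L, (∃ a ∈ A, a ≤ x) ↔ ¬ ∃ b ∈ B, x ≤ b

/-- `(l, r)` is a duality pair if `¬ l ≤ x ↔ x ≤ r` for all `x`. -/
def DualityPair {L : Type*} [Preorder L] (l r : L) : Prop :=
  ∀ x : L, ¬ l ≤ x ↔ x ≤ r

/-- An element is connected (join-prime) if `a ≤ b ⊔ c` implies `a ≤ b` or `a ≤ c`. -/
def ConnectedElt {L : Type*} [SemilatticeSup L] (a : L) : Prop :=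
  ∀ b c : L, a ≤ b ⊔ c → a ≤ b ∨ a ≤ c

/-- `L` has finite connected decompositions: every element is the supremum of a
finite nonempty set of connected elements. -/
def HasFiniteConnectedDecompositions (L : Type*) [SemilatticeSup L] : Prop :=
  ∀ a : L, ∃ (F : Finset L) (h : F.Nonempty),
    (∀ c ∈ F, ConnectedElt c) ∧ F.sup' h id = a

/-- `c` is a connected component of `a`: `c` is connected and either `c = a` or
there is `b` with `a = b ⊔ c ≠ b`. -/
def IsConnComponent {L : Type*} [SemilatticeSup L] (c a : L) : Prop :=
  ConnectedElt c ∧ (c = a ∨ ∃ b : L, a = b ⊔ c ∧ b ⊔ c ≠ b)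

/-- `connComponents A` is the set of connected components of elements of `A`. -/
def connComponents {L : Type*} [SemilatticeSup L] (A : Set L) : Set L :=
  {c | ∃ a ∈ A, IsConnComponent c a}

/-- A quasitransversal of `A`: an antichain `M ⊆ A_Cn` with `A ⊆ ↑M`. -/
def IsQuasitransversal {L : Type*} [SemilatticeSup L] (M A : Set L) : Prop :=
  M ⊆ connComponents A ∧ IsAntichain (· ≤ ·) M ∧ A ⊆ upSet M

/-- A transversal of `A`: a quasitransversal maximal in the refinement order
`M ⊴ N ↔ N ⊆ ↑M`. -/
def IsTransversal {L : Type*} [SemilatticeSup L] (M A : Set L) : Prop :=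
  IsQuasitransversal M A ∧
    ∀ N : Set L, IsQuasitransversal N A → N ⊆ upSet M → N = M

/-- The set of weak left duals: elements of `A` for some finite duality `(A, B)`
with `B` nonempty. -/
def wld (L : Type*) [Preorder L] : Set L :=
  {a | ∃ A B : Set L, FiniteDuality A B ∧ B.Nonempty ∧ a ∈ A}

/-- The sparse incomparability axiom. -/
def SIA (L : Type*) [Preorder L] : Prop :=
  ∀ (x : L) (M U : Set L), M.Finite → U.Finite →
    (insert x (upSet U)) ∩ wld L = ∅ →
    ∃ y : L, y ∉ wld L ∧ y ≤ x ∧ y ∉ upSet (insert x U) ∧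
      ∀ m ∈ M, (y ≤ m ↔ x ≤ m)

/-- If `b` is the largest element above no member of `M`, then every minimal `m ∈ M` is a left
dual, with right dual `m ⇨ b`. -/
theorem dualityPair_himp_of_minimal {L : Type*} [HeytingAlgebra L] {M : Set L} {b m : L}
    (hb : ∀ x, x ≤ b ↔ ∀ m ∈ M, ¬ m ≤ x) (hm : Minimal (· ∈ M) m) :
    DualityPair m (m ⇨ b) := by
  intro x
  rw [le_himp_iff, hb]
  constructor
  · intro hx m' hm' hle
    exact hx ((hm.2 hm' (hle.trans inf_le_right)).trans (hle.trans inf_le_left))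
  · intro h hx
    exact h m hm.1 (le_inf hx le_rfl)

/-- For each `b` on the right side of a finite duality there is a finite set `M` such that
`b` is the largest element above no member of `M`. -/
theorem FiniteDuality.exists_finite_forall_le_iff {L : Type*} [SemilatticeSup L]
    (hL : HasFiniteConnectedDecompositions L) {A B : Set L} (h : FiniteDuality A B)
    (hA : A.Nonempty) {b : L} (hb : b ∈ B) :
    ∃ M : Set L, M.Finite ∧ M.Nonempty ∧ ∀ x, x ≤ b ↔ ∀ m ∈ M, ¬ m ≤ x := by
  obtain ⟨hAfin, -, -, hBanti, hAB⟩ := h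
  choose F hF hconn hsup using hL
  have hcomp : ∀ a ∈ A, ∃ m ∈ F a, ¬ m ≤ b := by
    intro a ha
    by_contra! hle
    refine (hAB a).1 ⟨a, ha, le_rfl⟩ ⟨b, hb, ?_⟩
    rw [← hsup a]
    exact Finset.sup'_le _ _ hle
  have hFle : ∀ a, ∀ m ∈ F a, m ≤ a := fun a m hm =>
    (Finset.le_sup' id hm).trans_eq (hsup a)
  refine ⟨{m ∈ ⋃ a ∈ A, (F a : Set L) | ¬ m ≤ b},
    (hAfin.biUnion fun a _ => (F a).finite_toSet).subset (Set.sep_subset _ _), ?_, ?_⟩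
  · obtain ⟨a, ha⟩ := hA
    obtain ⟨m, hm, hmb⟩ := hcomp a ha
    exact ⟨m, Set.mem_biUnion ha hm, hmb⟩
  · refine fun x => ⟨fun hx m hm hmx => hm.2 (hmx.trans hx), fun hx => ?_⟩
    have hnot : ¬ ∃ a ∈ A, a ≤ x ⊔ b := by
      rintro ⟨a, ha, hle⟩
      obtain ⟨m, hm, hmb⟩ := hcomp a ha
      rcases hconn a m hm x b ((hFle a m hm).trans hle) with h | h
      · exact hx m ⟨Set.mem_biUnion ha hm, hmb⟩ h
      · exact hmb h
    obtain ⟨b', hb', hle⟩ := not_not.1 (mt (hAB (x ⊔ b)).2 hnot)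
    rw [hBanti.eq hb hb' (le_sup_right.trans hle)]
    exact le_sup_left.trans hle

/-- if a Heyting algebra with finite connected decompositions
contains no duality pair, it admits no finite duality with both sides nonempty. -/
theorem no_dualityPair_no_finiteDuality {L : Type*} [HeytingAlgebra L]
    (hL : HasFiniteConnectedDecompositions L)
    (hnone : ∀ l r : L, ¬ DualityPair l r) :
    ∀ A B : Set L, FiniteDuality A B → A.Nonempty → B.Nonempty → False := by
  rintro A B h hA ⟨b, hb⟩
  obtain ⟨M, hMfin, hMne, hM⟩ := h.exists_finite_forall_le_iff hL hA hb
  obtain ⟨m, hm⟩ := hMfin.exists_minimal hMne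
  exact hnone _ _ (dualityPair_himp_of_minimal hM hm)
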